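/- arXiv:2603.23778 — 4 statements merged into one kernel-verified Lean document; each statement's English description precedes it below -/
import Mathlib

section
/- Let V be a finite-dimensional real normed vector space, let x ∈ V, let r > 0, let 0 ≤ κ < 1/2, and let Φ : V → V be a continuous map such that ‖Φ(v) − (x + v)‖ ≤ κ‖v‖ for all v with ‖v‖ ≤ r. Then the open ball B(x, r/2) is contained in the image Φ(B(0, r)) of the open ball B(0, r). -/
open MeasureTheory Metric Set Filter Topology

/-- Evaluation at `1` of real polynomials of bounded degree is a combination of evaluations at
points arbitrarily close to `0`. -/
theorem exists_eval_one_eq_sum (n : ℕ) {ε : ℝ} (hε : 0 < ε) :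
    ∃ t w : ℕ → ℝ, (∀ i, 0 < t i ∧ t i < ε) ∧ ∀ p : Polynomial ℝ, p.natDegree ≤ n →
      p.eval 1 = ∑ i ∈ Finset.range (n + 1), w i * p.eval (t i) := by
  refine ⟨fun i => ε / (i + 2), fun i => (Lagrange.basis (Finset.range (n + 1))
    (fun i : ℕ => ε / ((i : ℝ) + 2)) i).eval 1, fun i => ⟨by positivity, ?_⟩, fun p hp => ?_⟩
  · rw [div_lt_iff₀ (by positivity)]
    nlinarith [(Nat.cast_nonneg i : (0 : ℝ) ≤ i)]
  · have hinj : Set.InjOn (fun i : ℕ => ε / ((i : ℝ) + 2)) (Finset.range (n + 1)) := by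
      intro i _ j _ hij
      have hi : (i : ℝ) + 2 ≠ 0 := by positivity
      have hj : (j : ℝ) + 2 ≠ 0 := by positivity
      simp only at hij
      rw [div_eq_div_iff hi hj] at hij
      have := mul_left_cancel₀ hε.ne' hij
      exact_mod_cast (by linarith : (i : ℝ) = j)
    have hdeg : p.degree < (Finset.range (n + 1)).card := by
      rw [Finset.card_range]
      exact lt_of_le_of_lt Polynomial.degree_le_natDegree (by exact_mod_cast Nat.lt_succ_of_le hp)
    conv_lhs => rw [Lagrange.eq_interpolate hinj hdeg, Lagrange.interpolate_apply]
    simp [Polynomial.eval_finsetSum, mul_comm]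

theorem ContinuousLinearMap.exists_polynomial_eval_eq_det {E : Type*} [NormedAddCommGroup E]
    [NormedSpace ℝ E] [FiniteDimensional ℝ E] (A : E →L[ℝ] E) :
    ∃ p : Polynomial ℝ, p.natDegree ≤ Module.finrank ℝ E ∧
      ∀ t : ℝ, p.eval t = (1 + t • A).det := by
  let b := Module.finBasis ℝ E
  let M := LinearMap.toMatrix b b (A : E →ₗ[ℝ] E)
  refine ⟨_, (Polynomial.natDegree_det_X_add_C_le M 1).trans_eq (Fintype.card_fin _), fun t => ?_⟩
  rw [ContinuousLinearMap.det, ← LinearMap.det_toMatrix b, ← Polynomial.coe_evalRingHom,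
    RingHom.map_det]
  congr 1
  ext i j
  have h1 : LinearMap.toMatrix b b ((1 + t • A : E →L[ℝ] E) : E →ₗ[ℝ] E) = 1 + t • M := by
    rw [ContinuousLinearMap.toLinearMap_add, map_add, ContinuousLinearMap.toLinearMap_smul, map_smul]
    congr 1
    exact LinearMap.toMatrix_one b
  rw [h1]
  simp [M, Matrix.one_apply, apply_ite, add_comm, mul_comm t]

theorem bijective_add_of_lipschitzWith {E : Type*} [NormedAddCommGroup E] [CompleteSpace E]
    {g : E → E} {K : NNReal} (hK : K < 1) (hg : LipschitzWith K g) :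
    Function.Bijective fun x => x + g x := by
  constructor
  · intro x y hxy
    have h1 := hg.dist_le_mul x y
    have h2 : dist x y = dist (g x) (g y) := by
      rw [dist_eq_norm, dist_eq_norm, ← norm_neg (g x - g y)]
      congr 1
      simp only at hxy
      rw [neg_sub, sub_eq_sub_iff_add_eq_add, hxy, add_comm]
    have hK' : (K : ℝ) < 1 := by exact_mod_cast hK
    exact dist_le_zero.1 (by nlinarith [dist_nonneg (x := x) (y := y)])
  · intro y
    have hc : ContractingWith K fun x => y - g x :=
      ⟨hK, LipschitzWith.of_dist_le_mul fun a b => by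
        simpa [dist_eq_norm, norm_sub_rev] using hg.dist_le_mul b a⟩
    exact ⟨hc.fixedPoint, by
      have := hc.fixedPoint_isFixedPt
      simp only [Function.IsFixedPt] at this
      exact (eq_sub_iff_add_eq.1 this.symm)⟩

/-- Extending by zero a Lipschitz map on a ball that vanishes on the sphere. -/
theorem lipschitzWith_indicator_closedBall {E F : Type*} [NormedAddCommGroup E] [NormedSpace ℝ E]
    [NormedAddCommGroup F] {g : E → F} {K : NNReal} {R : ℝ}
    (hg : LipschitzOnWith K g (closedBall 0 R)) (h0 : ∀ x, ‖x‖ = R → g x = 0) :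
    LipschitzWith K ((closedBall (0 : E) R).indicator g) := by
  have key : ∀ x ∈ closedBall (0 : E) R, ∀ y ∉ closedBall (0 : E) R, ‖g x‖ ≤ K * dist x y := by
    intro x hx y hy
    have hx' : ‖x‖ ≤ R := by simpa using hx
    have hy' : R ≤ ‖y‖ := by simpa using (not_le.1 (by simpa using hy)).le
    have hc : Continuous fun t : ℝ => ‖AffineMap.lineMap x y t‖ :=
      (AffineMap.lineMap_continuous (p := x) (q := y)).norm
    obtain ⟨t, ht, hz⟩ := intermediate_value_Icc (zero_le_one (α := ℝ)) hc.continuousOn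
      (show R ∈ Icc _ _ by simpa using ⟨hx', hy'⟩)
    have hL := hg.dist_le_mul x hx (AffineMap.lineMap x y t) (by simpa using hz.le)
    rw [h0 _ hz, dist_zero_right, dist_left_lineMap, Real.norm_of_nonneg ht.1] at hL
    refine hL.trans (mul_le_mul_of_nonneg_left ?_ K.2)
    nlinarith [ht.2, dist_nonneg (x := x) (y := y)]
  refine LipschitzWith.of_dist_le_mul fun x y => ?_
  by_cases hx : x ∈ closedBall (0 : E) R <;> by_cases hy : y ∈ closedBall (0 : E) R
  · simpa [indicator_of_mem hx, indicator_of_mem hy] using hg.dist_le_mul x hx y hy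
  · simpa [indicator_of_mem hx, indicator_of_notMem hy] using key x hx y hy
  · rw [dist_comm, dist_comm x y]
    simpa [indicator_of_notMem hx, indicator_of_mem hy] using key y hy x hx
  · simp only [indicator_of_notMem hx, indicator_of_notMem hy, dist_self]
    positivity

theorem exists_forall_norm_lt_det_one_add_pos {E : Type*} [NormedAddCommGroup E]
    [NormedSpace ℝ E] :
    ∃ δ > 0, ∀ B : E →L[ℝ] E, ‖B‖ < δ → 0 < (1 + B).det := by
  have hc : Continuous fun B : E →L[ℝ] E => (1 + B).det :=
    ContinuousLinearMap.continuous_det.comp (continuous_const.add continuous_id)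
  have h0 : (0 : ℝ) < (1 + (0 : E →L[ℝ] E)).det := by
    rw [add_zero]
    have : (1 : E →L[ℝ] E).det = 1 := by simp [ContinuousLinearMap.det]
    rw [this]; exact one_pos
  obtain ⟨δ, hδ, h⟩ := Metric.eventually_nhds_iff.1 (hc.continuousAt.eventually (lt_mem_nhds h0))
  exact ⟨δ, hδ, fun B hB => h (by simpa using hB)⟩

/-- A `C¹` map fixing a sphere pointwise gives a path of maps from the identity, along which the
volume of the ball is initially preserved. -/
theorem exists_forall_setIntegral_det_eq {E : Type*} [NormedAddCommGroup E] [NormedSpace ℝ E]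
    [FiniteDimensional ℝ E] [MeasurableSpace E] [BorelSpace E] (μ : Measure E) [μ.IsAddHaarMeasure]
    {f : E → E} (hf : ContDiff ℝ 1 f) {R : ℝ} (hfix : ∀ x, ‖x‖ = R → f x = x) :
    ∃ ε > 0, ∀ t : ℝ, 0 < t → t < ε →
      ∫ x in ball (0 : E) R, (1 + t • (fderiv ℝ f x - 1)).det ∂μ = μ.real (ball 0 R) := by
  obtain ⟨K, hK⟩ := (hf.sub contDiff_id).contDiffOn.exists_lipschitzOnWith one_ne_zero
    (convex_closedBall (0 : E) R) (isCompact_closedBall (0 : E) R)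
  set G := (closedBall (0 : E) R).indicator (fun x => f x - id x) with hG
  have hGL : LipschitzWith K G := lipschitzWith_indicator_closedBall hK
    fun x hx => by simp [hfix x hx]
  have hG0 : ∀ x ∉ ball (0 : E) R, G x = 0 := by
    intro x hx
    by_cases hx' : x ∈ closedBall (0 : E) R
    · have : ‖x‖ = R := le_antisymm (by simpa using hx') (by simpa using hx)
      simp [hG, indicator_of_mem hx', hfix x this]
    · exact indicator_of_notMem hx' _
  have hGd : ∀ x ∈ ball (0 : E) R, HasFDerivAt G (fderiv ℝ f x - 1) x := by
    intro x hx
    refine (((hf.differentiable one_ne_zero) x).hasFDerivAt.sub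
      (hasFDerivAt_id x)).congr_of_eventuallyEq ?_
    filter_upwards [isOpen_ball.mem_nhds hx] with y hy
    simp [hG, indicator_of_mem (ball_subset_closedBall hy)]
  obtain ⟨δ, hδ, hdet⟩ := exists_forall_norm_lt_det_one_add_pos (E := E)
  have hK1 : (0 : ℝ) < K + 1 := by positivity
  refine ⟨min δ 1 / (K + 1), by positivity, fun t ht0 ht => ?_⟩
  rw [lt_div_iff₀ hK1] at ht
  have htδ : t * K < δ := by nlinarith [min_le_left δ 1]
  have ht1 : t * K < 1 := by nlinarith [min_le_right δ 1]
  have hbij : Function.Bijective fun x => x + t • G x := by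
    refine bijective_add_of_lipschitzWith (K := ‖t‖₊ * K) ?_ ?_
    · rw [← NNReal.coe_lt_coe]
      simpa [abs_of_pos ht0] using ht1
    · exact (lipschitzWith_smul t).comp hGL
  have himage : (fun x => x + t • G x) '' ball 0 R = ball 0 R := by
    have hcompl : ∀ x ∉ ball (0 : E) R, x + t • G x = x := fun x hx => by simp [hG0 x hx]
    apply Subset.antisymm
    · rintro _ ⟨x, hx, rfl⟩
      by_contra hz
      exact hz (by simpa only [hbij.1 (hcompl _ hz)] using hx)
    · intro y hy
      obtain ⟨x, hx⟩ := hbij.2 y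
      refine ⟨x, ?_, hx⟩
      by_contra hx'
      exact hx' (by rw [← hcompl x hx']; exact mem_of_eq_of_mem hx hy)
  have hcv := integral_image_eq_integral_abs_det_fderiv_smul μ (measurableSet_ball (x := 0) (ε := R))
    (fun x hx => ((hasFDerivAt_id x).add ((hGd x hx).const_smul t)).hasFDerivWithinAt)
    (hbij.1.injOn) (fun _ => (1 : ℝ))
  have himage' : (id + t • G) '' ball 0 R = ball 0 R := himage
  rw [himage'] at hcv
  rw [setIntegral_const, smul_eq_mul, mul_one] at hcv
  rw [hcv]
  refine setIntegral_congr_fun measurableSet_ball fun x hx => ?_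
  have hpos : 0 < (1 + t • (fderiv ℝ f x - 1)).det := by
    apply hdet
    rw [norm_smul, Real.norm_of_nonneg ht0.le]
    refine lt_of_le_of_lt (mul_le_mul_of_nonneg_left ?_ ht0.le) htδ
    exact (hGd x hx).le_of_lipschitz hGL
  simp only [smul_eq_mul, mul_one]
  exact (abs_of_pos hpos).symm

theorem setIntegral_det_fderiv_eq_of_fix_sphere {E : Type*} [NormedAddCommGroup E]
    [NormedSpace ℝ E] [FiniteDimensional ℝ E] [MeasurableSpace E] [BorelSpace E] (μ : Measure E)
    [μ.IsAddHaarMeasure] {f : E → E} (hf : ContDiff ℝ 1 f) {R : ℝ}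
    (hfix : ∀ x, ‖x‖ = R → f x = x) :
    ∫ x in ball (0 : E) R, (fderiv ℝ f x).det ∂μ = μ.real (ball 0 R) := by
  obtain ⟨ε, hε, hvol⟩ := exists_forall_setIntegral_det_eq μ hf hfix
  obtain ⟨t, w, ht, hw⟩ := exists_eval_one_eq_sum (Module.finrank ℝ E) hε
  have hsum : ∑ i ∈ Finset.range (Module.finrank ℝ E + 1), w i = 1 := by
    simpa using (hw 1 (by simp)).symm
  have hpt : ∀ x, (fderiv ℝ f x).det = ∑ i ∈ Finset.range (Module.finrank ℝ E + 1),
      w i * (1 + t i • (fderiv ℝ f x - 1)).det := by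
    intro x
    obtain ⟨p, hp, hpe⟩ := (fderiv ℝ f x - 1).exists_polynomial_eval_eq_det
    have := hw p hp
    simpa only [hpe, one_smul, add_sub_cancel] using this
  have hint : ∀ s : ℝ, IntegrableOn (fun x => (1 + s • (fderiv ℝ f x - 1)).det) (ball 0 R) μ := by
    intro s
    have hc : Continuous fun x => (1 + s • (fderiv ℝ f x - 1)).det :=
      ContinuousLinearMap.continuous_det.comp (continuous_const.add
        (((hf.continuous_fderiv one_ne_zero).sub continuous_const).const_smul s))
    exact (hc.continuousOn.integrableOn_compact (isCompact_closedBall 0 R)).mono_set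
      ball_subset_closedBall
  simp only [hpt]
  rw [integral_finsetSum _ fun i _ => (hint (t i)).const_mul (w i)]
  simp only [integral_const_mul, hvol _ (ht _).1 (ht _).2, ← Finset.sum_mul, hsum, one_mul]

/-- There is no `C¹` retraction onto a sphere. -/
theorem not_contDiff_retraction_sphere {E : Type*} [NormedAddCommGroup E]
    [InnerProductSpace ℝ E] [FiniteDimensional ℝ E] {f : E → E} (hf : ContDiff ℝ 1 f) {R : ℝ}
    (hR : 0 < R) (hfix : ∀ x, ‖x‖ = R → f x = x) (hnorm : ∀ x, ‖f x‖ = R) : False := by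
  borelize E
  have hdet : ∀ x, (fderiv ℝ f x).det = 0 := by
    intro x
    by_contra hne
    obtain ⟨v, hv⟩ := ((fderiv ℝ f x).toContinuousLinearEquivOfDetNeZero hne).surjective (f x)
    have hv : fderiv ℝ f x v = f x := hv
    have h1 := ((hf.differentiable one_ne_zero) x).hasFDerivAt.norm_sq
    simp only [hnorm] at h1
    have h2 := DFunLike.congr_fun (h1.unique (hasFDerivAt_const _ _)) v
    simp [hv, hnorm, hR.ne'] at h2
  have h := setIntegral_det_fderiv_eq_of_fix_sphere Measure.addHaar hf hfix
  simp only [hdet, integral_zero] at h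
  exact (ENNReal.toReal_pos (measure_ball_pos Measure.addHaar (0 : E) hR).ne'
    measure_ball_lt_top.ne).ne h

theorem ContDiff.exists_fixedPoint_of_hasCompactSupport {E : Type*} [NormedAddCommGroup E]
    [InnerProductSpace ℝ E] [FiniteDimensional ℝ E] {F : E → E} (hF : ContDiff ℝ 1 F)
    (hsupp : HasCompactSupport F) : ∃ x, F x = x := by
  by_contra! hne
  have hne' : ∀ x, x - F x ≠ 0 := fun x h => hne x (sub_eq_zero.1 h).symm
  obtain ⟨R, hR, hsub⟩ := hsupp.isBounded.subset_ball_lt 0 (0 : E)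
  have hh : ContDiff ℝ 1 fun x => x - F x := contDiff_id.sub hF
  refine not_contDiff_retraction_sphere (f := fun x => (R * ‖x - F x‖⁻¹) • (x - F x))
    ((contDiff_const.mul ((hh.norm ℝ hne').inv fun x => norm_ne_zero_iff.2 (hne' x))).smul hh)
    hR (fun x hx => ?_) fun x => ?_
  · have : F x = 0 := image_eq_zero_of_notMem_tsupport fun h => by simpa [hx] using hsub h
    simp [this, hx, hR.ne']
  · rw [norm_smul, norm_mul, norm_inv, norm_norm, Real.norm_of_nonneg hR.le,
      inv_mul_cancel_right₀ (norm_ne_zero_iff.2 (hne' x))]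

theorem Continuous.exists_fixedPoint_of_hasCompactSupport {E : Type*} [NormedAddCommGroup E]
    [InnerProductSpace ℝ E] [FiniteDimensional ℝ E] {F : E → E} (hF : Continuous F)
    (hsupp : HasCompactSupport F) : ∃ x, F x = x := by
  by_contra! hne
  borelize E
  obtain ⟨R, hR, hsub⟩ := hsupp.isBounded.subset_ball_lt 0 (0 : E)
  obtain ⟨x₀, -, hx₀⟩ := (isCompact_closedBall (0 : E) R).exists_isMinOn
    ⟨0, mem_closedBall_self hR.le⟩ (continuous_id.sub hF).norm.continuousOn
  have hδ : 0 < min R ‖x₀ - F x₀‖ :=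
    lt_min hR (norm_pos_iff.2 (sub_ne_zero.2 (hne x₀).symm))
  have hmin : ∀ x, min R ‖x₀ - F x₀‖ ≤ ‖x - F x‖ := by
    intro x
    by_cases hx : x ∈ closedBall (0 : E) R
    · exact (min_le_right _ _).trans (hx₀ hx)
    · have : F x = 0 := image_eq_zero_of_notMem_tsupport fun h =>
        hx (ball_subset_closedBall (hsub h))
      rw [this, sub_zero]
      exact (min_le_left _ _).trans (not_le.1 (by simpa using hx)).le
  set δ := min R ‖x₀ - F x₀‖
  obtain ⟨η, hη, huc⟩ := Metric.uniformContinuous_iff.1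
    (hsupp.uniformContinuous_of_continuous hF) (δ / 2) (half_pos hδ)
  let φ : ContDiffBump (0 : E) := ⟨η / 2, η, half_pos hη, half_lt_self hη⟩
  let H := convolution (φ.normed Measure.addHaar) F (ContinuousLinearMap.lsmul ℝ ℝ)
    Measure.addHaar
  have hHc : HasCompactSupport H := φ.hasCompactSupport_normed.convolution _ hsupp
  have hHd : ContDiff ℝ 1 H := φ.hasCompactSupport_normed.contDiff_convolution_left (n := 1) _
    φ.contDiff_normed hF.locallyIntegrable
  obtain ⟨x, hx⟩ := hHd.exists_fixedPoint_of_hasCompactSupport hHc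
  have hd : dist (H x) (F x) ≤ δ / 2 :=
    φ.dist_normed_convolution_le hF.aestronglyMeasurable fun y hy => (huc hy).le
  rw [hx, dist_eq_norm] at hd
  linarith [hmin x]

theorem Continuous.exists_fixedPoint_of_bounded {V : Type*} [NormedAddCommGroup V]
    [NormedSpace ℝ V] [FiniteDimensional ℝ V] {F : V → V} (hF : Continuous F) {M : ℝ}
    (hM : ∀ x, ‖F x‖ ≤ M) : ∃ x, F x = x := by
  have hM0 : 0 ≤ M := (norm_nonneg _).trans (hM 0)
  let φ : ContDiffBump (0 : V) := ⟨M + 1, M + 2, by linarith, by linarith⟩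
  let e : V ≃L[ℝ] EuclideanSpace ℝ (Fin (Module.finrank ℝ V)) := toEuclidean
  have hcs : HasCompactSupport fun x => φ x • F x := φ.hasCompactSupport.smul_right
  have hc : Continuous fun x => φ x • F x := φ.continuous.smul hF
  have hcs' : HasCompactSupport fun y => e (φ (e.symm y) • F (e.symm y)) :=
    (hcs.comp_homeomorph e.symm.toHomeomorph).comp_left (g := e) (map_zero e)
  obtain ⟨y, hy⟩ :=
    (e.continuous.comp (hc.comp e.symm.continuous)).exists_fixedPoint_of_hasCompactSupport hcs'
  have hyfix : φ (e.symm y) • F (e.symm y) = e.symm y := by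
    apply e.injective
    simpa using hy
  refine ⟨e.symm y, ?_⟩
  have hle : ‖e.symm y‖ ≤ M := by
    rw [← hyfix, norm_smul, Real.norm_of_nonneg φ.nonneg]
    exact (mul_le_of_le_one_left (norm_nonneg _) φ.le_one).trans (hM _)
  have h1 : φ (e.symm y) = 1 := φ.one_of_mem_closedBall (by
    rw [mem_closedBall_zero_iff]; exact hle.trans (by simp [φ]))
  rwa [h1, one_smul] at hyfix

/-- **Brouwer fixed point theorem** for closed balls. -/
theorem exists_fixedPoint_closedBall {V : Type*} [NormedAddCommGroup V]
    [NormedSpace ℝ V] [FiniteDimensional ℝ V] {r : ℝ} (hr : 0 < r) {g : V → V}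
    (hg : ContinuousOn g (closedBall 0 r)) (hmaps : MapsTo g (closedBall 0 r) (closedBall 0 r)) :
    ∃ x ∈ closedBall (0 : V) r, g x = x := by
  have hpos : ∀ v : V, 0 < max r ‖v‖ := fun v => lt_max_of_lt_left hr
  let P : V → V := fun v => (r / max r ‖v‖) • v
  have hP : ∀ v, P v ∈ closedBall (0 : V) r := by
    intro v
    rw [mem_closedBall_zero_iff, norm_smul, Real.norm_of_nonneg (div_pos hr (hpos v)).le,
      div_mul_eq_mul_div, div_le_iff₀ (hpos v)]
    exact mul_le_mul_of_nonneg_left (le_max_right _ _) hr.le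
  have hPc : Continuous P :=
    (continuous_const.div (continuous_const.max continuous_norm) fun v => (hpos v).ne').smul
      continuous_id
  obtain ⟨x, hx⟩ := (hg.comp_continuous hPc hP).exists_fixedPoint_of_bounded (M := r)
    fun v => by simpa using hmaps (hP v)
  have hxr : x ∈ closedBall (0 : V) r := by rw [← hx]; exact hmaps (hP x)
  have hPx : P x = x := by
    simp [P, max_eq_left (mem_closedBall_zero_iff.1 hxr), hr.ne']
  exact ⟨x, hxr, by rwa [Function.comp_apply, hPx] at hx⟩

theorem stmt_0 {V : Type*} [NormedAddCommGroup V] [NormedSpace ℝ V]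
    [FiniteDimensional ℝ V] (x : V) (r : ℝ) (hr : 0 < r) (κ : ℝ)
    (hκ0 : 0 ≤ κ) (hκ : κ < 1 / 2) (Φ : V → V) (hΦ : Continuous Φ)
    (hclose : ∀ v : V, ‖v‖ ≤ r → ‖Φ v - (x + v)‖ ≤ κ * ‖v‖) :
    Metric.ball x (r / 2) ⊆ Φ '' Metric.ball (0 : V) r := by
  intro y hy
  have hlt : ∀ v : V, ‖v‖ ≤ r → ‖(y - x) - (Φ v - (x + v))‖ < r := by
    intro v hv
    have h1 := norm_sub_le (y - x) (Φ v - (x + v))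
    have h2 : ‖y - x‖ < r / 2 := by simpa [dist_eq_norm] using hy
    nlinarith [hclose v hv]
  obtain ⟨v, hv, hfix⟩ := exists_fixedPoint_closedBall hr
    (g := fun v => (y - x) - (Φ v - (x + v))) (by fun_prop)
    fun v hv => by simpa using (hlt v (by simpa using hv)).le
  refine ⟨v, ?_, ?_⟩
  · have := hlt v (by simpa using hv)
    rw [hfix] at this
    simpa using this
  · have : y - Φ v + v = v := by
      conv_rhs => rw [← hfix]
      abel
    exact (sub_eq_zero.1 (by simpa using this)).symm
end

section
/- Let V be a finite-dimensional real normed vector space, let x ∈ V, let 0 ≤ κ < 1/2, and let Φ : V → V be a continuous map such that ‖Φ(v) − (x + v)‖ ≤ κ‖v‖ for all v ∈ V. Then Φ is surjective. -/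
open MeasureTheory Polynomial Filter Topology Metric Set

/-- For an integrand polynomial in a parameter, a value of the integral attained for all small
positive parameters is attained for every parameter. -/
theorem integral_eq_of_forall_small_of_polynomial {α : Type*} [MeasurableSpace α] {μ : Measure α}
    {F : α → ℝ → ℝ} {d : ℕ} {c ε : ℝ} (hε : 0 < ε)
    (hF : ∀ x, ∃ p : ℝ[X], p.natDegree ≤ d ∧ ∀ t, F x t = p.eval t)
    (hint : ∀ t, Integrable (fun x ↦ F x t) μ)
    (hc : ∀ t, 0 < t → t < ε → ∫ x, F x t ∂μ = c) (s : ℝ) :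
    ∫ x, F x s ∂μ = c := by
  choose p hp hpF using hF
  let v : ℕ → ℝ := fun i ↦ ε / (i + 2)
  have hv : Function.Injective v := by
    intro i j hij
    have : (i + 2 : ℝ) = j + 2 := by
      simpa [v, div_eq_mul_inv, hε.ne'] using hij
    exact_mod_cast add_right_cancel this
  have hv0 : ∀ i, 0 < v i := fun i ↦ by positivity
  have hvε : ∀ i, v i < ε := fun i ↦ div_lt_self hε (by linarith [i.cast_nonneg (α := ℝ)])
  set S := Finset.range (d + 1)
  have hinj : Set.InjOn v S := hv.injOn
  have key : ∀ x, F x s = ∑ i ∈ S, F x (v i) * (Lagrange.basis S v i).eval s := by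
    intro x
    have hdeg : (p x).degree < S.card := by
      refine degree_le_natDegree.trans_lt ?_
      simp only [S, Finset.card_range]
      exact_mod_cast Nat.lt_succ_of_le (hp x)
    have := congrArg (eval s) (Lagrange.eq_interpolate hinj hdeg)
    rw [Lagrange.interpolate_apply, eval_finsetSum] at this
    simpa [hpF] using this
  simp_rw [key]
  rw [integral_finsetSum _ fun i _ ↦ (hint _).mul_const _]
  simp_rw [integral_mul_const, hc _ (hv0 _) (hvε _)]
  rw [← Finset.mul_sum, ← eval_finsetSum, Lagrange.sum_basis hinj ⟨0, by simp [S]⟩]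
  simp

theorem exists_polynomial_det_one_add_smul {V : Type*} [NormedAddCommGroup V] [NormedSpace ℝ V]
    [FiniteDimensional ℝ V] (L : V →L[ℝ] V) :
    ∃ p : ℝ[X], p.natDegree ≤ Module.finrank ℝ V ∧
      ∀ t : ℝ, (1 + t • L : V →L[ℝ] V).det = p.eval t := by
  let b := Module.finBasis ℝ V
  refine ⟨_, (natDegree_det_X_add_C_le (LinearMap.toMatrix b b L) 1).trans (by simp), fun t ↦ ?_⟩
  rw [ContinuousLinearMap.det, ← LinearMap.det_toMatrix b, ← coe_evalRingHom, RingHom.map_det]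
  congr 1
  ext i j
  by_cases h : i = j <;>
    simp [h, add_comm, mul_comm t, LinearMap.toMatrix_apply]

theorem exists_polynomial_sub_norm_sq_pow {E : Type*} [NormedAddCommGroup E]
    [InnerProductSpace ℝ E] (a b : E) (M : ℝ) (N : ℕ) :
    ∃ p : ℝ[X], p.natDegree ≤ N * 2 ∧ ∀ t : ℝ, (M - ‖a + t • b‖ ^ 2) ^ N = p.eval t := by
  refine ⟨(C (-‖b‖ ^ 2) * X ^ 2 + C (-2 * inner ℝ a b) * X + C (M - ‖a‖ ^ 2)) ^ N,
    natDegree_pow_le_of_le N natDegree_quadratic_le, fun t ↦ ?_⟩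
  rw [norm_add_sq_real, norm_smul, inner_smul_right, mul_pow, Real.norm_eq_abs, sq_abs]
  simp only [eval_pow, eval_add, eval_mul, eval_C, eval_X]
  ring

theorem ContractingWith.bijective_id_add {V : Type*} [NormedAddCommGroup V] [CompleteSpace V]
    {c : NNReal} {k : V → V} (hk : ContractingWith c k) :
    Function.Bijective fun v ↦ v + k v := by
  constructor
  · intro a b hab
    have hab : a + k a = b + k b := hab
    have h : dist a b = dist (k a) (k b) := by
      rw [dist_eq_norm, dist_comm (k a), dist_eq_norm]
      congr 1
      rw [sub_eq_sub_iff_add_eq_add, hab, add_comm]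
    have h1 := hk.2.dist_le_mul a b
    have h2 : (c : ℝ) < 1 := hk.1
    have h3 := dist_nonneg (x := a) (y := b)
    exact dist_le_zero.1 (by nlinarith)
  · intro y
    have hy : ContractingWith c fun v ↦ y - k v :=
      ⟨hk.1, LipschitzWith.of_dist_le_mul fun a b ↦ by
        rw [dist_sub_left]
        exact hk.2.dist_le_mul a b⟩
    exact ⟨hy.fixedPoint, eq_sub_iff_add_eq.1 hy.fixedPoint_isFixedPt.eq.symm⟩

section

variable {V : Type*} [NormedAddCommGroup V] [NormedSpace ℝ V] [FiniteDimensional ℝ V]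

theorem setIntegral_comp_id_add_mul_det [MeasurableSpace V] [BorelSpace V]
    (μ : Measure V) [μ.IsAddHaarMeasure] {h : V → V} (hh : Differentiable ℝ h)
    {c : NNReal} (hc : ContractingWith c h) (hdet : ∀ x, 0 < (1 + fderiv ℝ h x).det)
    {B : Set V} (hB : MeasurableSet B) (hsupp : ∀ x ∉ B, h x = 0) (f : V → ℝ) :
    ∫ x in B, f (x + h x) * (1 + fderiv ℝ h x).det ∂μ = ∫ x in B, f x ∂μ := by
  have hbij := hc.bijective_id_add
  have hcompl : (fun v ↦ v + h v) '' Bᶜ = Bᶜ := by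
    rw [image_congr (g := id) fun x hx ↦ by simp [hsupp x hx], image_id]
  have himage : (fun v ↦ v + h v) '' B = B := by
    rw [← compl_inj_iff, ← image_compl_eq hbij, hcompl]
  have key := integral_image_eq_integral_abs_det_fderiv_smul μ hB
    (f := fun v ↦ v + h v) (f' := fun x ↦ 1 + fderiv ℝ h x)
    (fun x _ ↦ ((hasFDerivAt_id x).add (hh x).hasFDerivAt).hasFDerivWithinAt)
    hbij.injective.injOn f
  rw [himage] at key
  rw [key]
  refine integral_congr_ae (Eventually.of_forall fun x ↦ ?_)
  simp only [abs_of_pos (hdet x), smul_eq_mul, mul_comm]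

/-- The degree formula `∫ (f ∘ φ) det (Dφ) = ∫ f` for a compactly supported perturbation `φ` of the
identity and a function `f` whose restrictions to lines are polynomials of bounded degree. -/
theorem setIntegral_comp_id_add_mul_det_of_polynomial [MeasurableSpace V] [BorelSpace V]
    (μ : Measure V) [μ.IsAddHaarMeasure] {h : V → V} (hh : ContDiff ℝ 1 h)
    {B : Set V} (hB : IsCompact B) (hsupp : ∀ x ∉ B, h x = 0) {f : V → ℝ} (hf : Continuous f)
    {d : ℕ} (hpoly : ∀ a b, ∃ p : ℝ[X], p.natDegree ≤ d ∧ ∀ t : ℝ, f (a + t • b) = p.eval t) :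
    ∫ x in B, f (x + h x) * (1 + fderiv ℝ h x).det ∂μ = ∫ x in B, f x ∂μ := by
  obtain ⟨K, hK⟩ := hh.lipschitzWith_of_hasCompactSupport
    (HasCompactSupport.intro hB hsupp) one_ne_zero
  have hdet : ∀ᶠ T : V →L[ℝ] V in 𝓝 0, 0 < (1 + T).det := by
    have : Continuous fun T : V →L[ℝ] V ↦ (1 + T).det :=
      ContinuousLinearMap.continuous_det.comp (by fun_prop)
    refine this.continuousAt.eventually (lt_mem_nhds ?_)
    simp [ContinuousLinearMap.det]
  obtain ⟨η, hη, hball⟩ := Metric.eventually_nhds_iff_ball.1 hdet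
  have hderiv := hh.continuous_fderiv one_ne_zero
  have hcont : ∀ t : ℝ, Continuous fun x ↦ f (x + t • h x) * (1 + t • fderiv ℝ h x).det := fun t ↦
    (hf.comp (continuous_id.add (hh.continuous.const_smul t))).mul
      (ContinuousLinearMap.continuous_det.comp (continuous_const.add (hderiv.const_smul t)))
  have key := integral_eq_of_forall_small_of_polynomial (μ := μ.restrict B)
    (F := fun x t ↦ f (x + t • h x) * (1 + t • fderiv ℝ h x).det)
    (d := d + Module.finrank ℝ V) (c := ∫ x in B, f x ∂μ) (ε := min 1 η / (K + 1))
    (by positivity) (fun x ↦ ?_) (fun t ↦ (hcont t).continuousOn.integrableOn_compact hB) ?_ 1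
  · simpa using key
  · obtain ⟨p, hp, hpf⟩ := hpoly x (h x)
    obtain ⟨q, hq, hqf⟩ := exists_polynomial_det_one_add_smul (fderiv ℝ h x)
    exact ⟨p * q, natDegree_mul_le_of_le hp hq, fun t ↦ by rw [hpf, hqf, eval_mul]⟩
  · intro t ht htε
    rw [lt_div_iff₀ (by positivity), mul_add, mul_one, lt_min_iff] at htε
    have hfd : ∀ x, fderiv ℝ (t • h) x = t • fderiv ℝ h x := fun x ↦
      fderiv_const_smul (hh.differentiable one_ne_zero x) t
    have hcontr : ContractingWith (‖t‖₊ * K) (t • h) := by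
      refine ⟨?_, ?_⟩
      · rw [← NNReal.coe_lt_coe]
        simp only [NNReal.coe_mul, coe_nnnorm, Real.norm_eq_abs, abs_of_pos ht, NNReal.coe_one]
        linarith
      · exact (lipschitzWith_smul t).comp hK
    have := setIntegral_comp_id_add_mul_det μ (h := t • h)
      ((hh.differentiable one_ne_zero).const_smul t) hcontr (fun x ↦ ?_) hB.measurableSet
      (fun x hx ↦ by simp [hsupp x hx]) f
    · simpa [hfd] using this
    · refine hball _ ?_
      rw [hfd, mem_ball_zero_iff, norm_smul, Real.norm_eq_abs, abs_of_pos ht]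
      have := norm_fderiv_le_of_lipschitz ℝ hK (x₀ := x)
      nlinarith

/-- A compactly supported `C¹` perturbation of the identity is surjective. -/
theorem ContDiff.surjective_id_add_of_hasCompactSupport {h : V → V} (hh : ContDiff ℝ 1 h)
    (hsupp : HasCompactSupport h) : Function.Surjective fun v ↦ v + h v := by
  let _ : MeasurableSpace V := borel V
  have _ : BorelSpace V := ⟨rfl⟩
  let μ : Measure V := Measure.addHaar
  intro y
  by_contra! hy
  obtain ⟨r, hr⟩ := hsupp.isCompact.isBounded.subset_ball y
  have hr0 : 0 < r := by
    have : y ∈ tsupport h := subset_tsupport h fun h0 ↦ hy y (by simp [h0])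
    simpa using hr this
  let B := closedBall y r
  have hB : IsCompact B := isCompact_closedBall y r
  have hhB : ∀ x ∉ B, h x = 0 := fun x hx ↦
    image_eq_zero_of_notMem_tsupport fun hx' ↦ hx (ball_subset_closedBall (hr hx'))
  have hyB : y ∈ B := mem_closedBall_self hr0.le
  let A := toEuclidean (E := V)
  let q : V → ℝ := fun z ↦ ‖A (z - y)‖ ^ 2
  have hq : Continuous q := by fun_prop
  have hqφ : Continuous fun x ↦ q (x + h x) := hq.comp (continuous_id.add hh.continuous)
  obtain ⟨x₀, hx₀, hmin⟩ := hB.exists_isMinOn ⟨y, hyB⟩ hqφ.continuousOn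
  obtain ⟨x₁, hx₁, hmax⟩ := hB.exists_isMaxOn ⟨y, hyB⟩ hqφ.continuousOn
  obtain ⟨x₂, hx₂, hmax'⟩ := hB.exists_isMaxOn ⟨y, hyB⟩ hq.continuousOn
  set δ := q (x₀ + h x₀)
  have hδ : 0 < δ := by
    have : A (x₀ + h x₀ - y) ≠ 0 := A.map_ne_zero_iff.2 (sub_ne_zero.2 (hy x₀))
    positivity
  set M := max (q (x₁ + h x₁)) (q x₂)
  have hM : ∀ x ∈ B, q (x + h x) ≤ M := fun x hx ↦ (hmax hx).trans (le_max_left _ _)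
  have hM' : ∀ x ∈ B, q x ≤ M := fun x hx ↦ (hmax' hx).trans (le_max_right _ _)
  have hδM : δ ≤ M := hM x₀ hx₀
  let S := ball y r ∩ {z | q z < δ / 2}
  have hSo : IsOpen S := isOpen_ball.inter (isOpen_lt hq continuous_const)
  have hSB : S ⊆ B := inter_subset_left.trans ball_subset_closedBall
  have hSfin : μ S ≠ ⊤ := (measure_mono hSB |>.trans_lt hB.measure_lt_top).ne
  have hS : 0 < μ.real S := by
    refine ENNReal.toReal_pos (hSo.measure_pos μ ⟨y, mem_ball_self hr0, ?_⟩).ne' hSfin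
    simpa [q] using hδ
  let J : V → ℝ := fun x ↦ (1 + fderiv ℝ h x).det
  have hJ : Continuous J := ContinuousLinearMap.continuous_det.comp
    (continuous_const.add (hh.continuous_fderiv one_ne_zero))
  let C := ∫ x in B, |J x| ∂μ
  have key : ∀ N : ℕ, (M - δ / 2) ^ N * μ.real S ≤ (M - δ) ^ N * C := by
    intro N
    have hf : Continuous fun z ↦ (M - q z) ^ N := by fun_prop
    have hdeg := setIntegral_comp_id_add_mul_det_of_polynomial μ hh hB hhB hf (d := N * 2)
      fun a b ↦ by
        obtain ⟨p, hp, hpe⟩ := exists_polynomial_sub_norm_sq_pow (A (a - y)) (A b) M N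
        refine ⟨p, hp, fun t ↦ ?_⟩
        rw [← hpe, ← map_smul, ← map_add]
        simp only [q, sub_add_eq_add_sub]
    calc (M - δ / 2) ^ N * μ.real S = ∫ _ in S, (M - δ / 2) ^ N ∂μ := by
          rw [setIntegral_const, smul_eq_mul, mul_comm]
      _ ≤ ∫ x in S, (M - q x) ^ N ∂μ := by
          refine setIntegral_mono_on (integrableOn_const hSfin)
            ((hf.continuousOn.integrableOn_compact hB).mono_set hSB) hSo.measurableSet
            fun x hx ↦ pow_le_pow_left₀ (by linarith) (sub_le_sub_left (le_of_lt hx.2) M) N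
      _ ≤ ∫ x in B, (M - q x) ^ N ∂μ := by
          refine setIntegral_mono_set (hf.continuousOn.integrableOn_compact hB) ?_
            (Eventually.of_forall hSB)
          filter_upwards [ae_restrict_mem hB.measurableSet] with x hx
          exact pow_nonneg (sub_nonneg.2 (hM' x hx)) N
      _ = ∫ x in B, (M - q (x + h x)) ^ N * J x ∂μ := hdeg.symm
      _ ≤ ∫ x in B, (M - δ) ^ N * |J x| ∂μ := by
          refine setIntegral_mono_on (Continuous.continuousOn (by fun_prop)
            |>.integrableOn_compact hB) (Continuous.continuousOn (by fun_prop)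
            |>.integrableOn_compact hB) hB.measurableSet fun x hx ↦ ?_
          have h0 : 0 ≤ M - q (x + h x) := sub_nonneg.2 (hM x hx)
          exact (mul_le_mul_of_nonneg_left (le_abs_self _) (pow_nonneg h0 N)).trans
            (mul_le_mul_of_nonneg_right (pow_le_pow_left₀ h0 (sub_le_sub_left (hmin hx) M) N)
              (abs_nonneg _))
      _ = (M - δ) ^ N * C := integral_const_mul _ _
  have hpos : 0 < M - δ / 2 := by linarith
  have hlim : Tendsto (fun N : ℕ ↦ ((M - δ) / (M - δ / 2)) ^ N * C) atTop (𝓝 (0 * C)) :=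
    (tendsto_pow_atTop_nhds_zero_of_lt_one (div_nonneg (by linarith) hpos.le)
      ((div_lt_one hpos).2 (by linarith))).mul_const C
  have : μ.real S ≤ 0 * C := ge_of_tendsto' hlim fun N ↦ by
    rw [div_pow, div_mul_eq_mul_div, le_div_iff₀ (pow_pos hpos N), mul_comm]
    exact key N
  linarith

end

theorem stmt_1 {V : Type*} [NormedAddCommGroup V] [NormedSpace ℝ V]
    [FiniteDimensional ℝ V] (x : V) (κ : ℝ)
    (hκ0 : 0 ≤ κ) (hκ : κ < 1 / 2) (Φ : V → V) (hΦ : Continuous Φ)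
    (hclose : ∀ v : V, ‖Φ v - (x + v)‖ ≤ κ * ‖v‖) :
    Function.Surjective Φ := by
  have hlower : ∀ v w, ‖Φ v - w‖ ≥ (1 - κ) * ‖v‖ - ‖w - x‖ := by
    intro v w
    have h1 : v = (Φ v - w) - (Φ v - (x + v)) + (w - x) := by abel
    have h2 : ‖v‖ ≤ ‖Φ v - w‖ + ‖Φ v - (x + v)‖ + ‖w - x‖ := by
      conv_lhs => rw [h1]
      exact (norm_add_le _ _).trans (add_le_add_left (norm_sub_le _ _) _)
    linarith [hclose v]
  have hclosed : IsClosed (range Φ) := by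
    refine IsClosedMap.isClosed_range (IsProperMap.isClosedMap ?_)
    refine isProperMap_iff_tendsto_cocompact.2 ⟨hΦ, ?_⟩
    rw [← cobounded_eq_cocompact, ← tendsto_norm_atTop_iff_cobounded]
    refine tendsto_atTop_mono (f := fun v ↦ (1 - κ) * ‖v‖ + -‖0 - x‖)
      (fun v ↦ by simpa [sub_eq_add_neg] using hlower v 0) ?_
    exact tendsto_atTop_add_const_right _ _
      (tendsto_norm_cobounded_atTop.const_mul_atTop (by linarith))
  intro y
  refine hclosed.closure_subset (Metric.mem_closure_range_iff.2 fun ε hε ↦ ?_)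
  set R := (‖y - x‖ + ε) / (1 - κ)
  let χ : V → ℝ := fun v ↦ max 0 (min 1 (R + 1 - ‖v‖))
  have hχ0 : ∀ v, 0 ≤ χ v := fun v ↦ le_max_left _ _
  have hχ1 : ∀ v, χ v ≤ 1 := fun v ↦ max_le zero_le_one (min_le_left _ _)
  have hχR : ∀ v, ‖v‖ ≤ R → χ v = 1 := fun v hv ↦ by
    simp only [χ]
    rw [min_eq_left (by linarith), max_eq_right zero_le_one]
  let h : V → V := fun v ↦ χ v • (Φ v - (x + v))
  have hh : Continuous h := by fun_prop
  have hsupp : HasCompactSupport h :=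
    HasCompactSupport.intro (isCompact_closedBall 0 (R + 1)) fun v hv ↦ by
      rw [mem_closedBall_zero_iff, not_le] at hv
      simp only [h, χ]
      rw [max_eq_left ((min_le_right _ _).trans (by linarith)), zero_smul]
  obtain ⟨g, hg, hgh, hgs⟩ := hh.exists_contDiff_approx 1 continuous_const fun _ ↦ hε
  obtain ⟨v, hv⟩ := hg.surjective_id_add_of_hasCompactSupport (hsupp.mono hgs) (y - x)
  have hv : v + g v = y - x := hv
  have hgv : ‖g v - h v‖ < ε := by simpa [dist_eq_norm] using hgh v
  have hhv : ‖h v‖ ≤ κ * ‖v‖ := by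
    rw [norm_smul, Real.norm_eq_abs, abs_of_nonneg (hχ0 v)]
    exact (mul_le_of_le_one_left (norm_nonneg _) (hχ1 v)).trans (hclose v)
  have hvR : ‖v‖ ≤ R := by
    rw [le_div_iff₀ (by linarith)]
    have h1 : v = (y - x) - (g v - h v) - h v := by rw [← hv]; abel
    have h2 : ‖v‖ ≤ ‖y - x‖ + ‖g v - h v‖ + ‖h v‖ := by
      conv_lhs => rw [h1]
      exact (norm_sub_le _ _).trans (add_le_add_left (norm_sub_le _ _) _)
    linarith
  refine ⟨v, ?_⟩
  have h3 : h v = Φ v - (x + v) := by simp only [h, hχR v hvR, one_smul]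
  have h4 : y - Φ v = g v - h v := by
    rw [h3, ← sub_add_cancel y x, ← hv]
    abel
  rwa [dist_eq_norm, h4]
end

section
/- Let V be a finite-dimensional real normed vector space, let x ∈ V, let 0 ≤ κ < 1, and let Φ : V → V be a continuous bijection such that ‖Φ(v) − (x + v)‖ ≤ κ‖v‖ for all v ∈ V. Then Φ is a homeomorphism, and for every w ∈ V the inverse satisfies ‖Φ⁻¹(w) − (w − x)‖ ≤ (κ/(1−κ))·‖w − x‖. -/
/-- If `Φ` is relatively close to the translation by `x`, then `Φ v - x` is bounded below by a
multiple of `v`. -/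
theorem one_sub_mul_norm_le_norm_sub {V : Type*} [SeminormedAddCommGroup V] {x v : V} {κ : ℝ}
    {Φ : V → V} (h : ‖Φ v - (x + v)‖ ≤ κ * ‖v‖) : (1 - κ) * ‖v‖ ≤ ‖Φ v - x‖ := by
  have h₁ : ‖v‖ ≤ ‖Φ v - x‖ + ‖Φ v - (x + v)‖ := by
    simpa [← sub_sub] using norm_sub_le (Φ v - x) (Φ v - (x + v))
  linarith

/-- A continuous map relatively close to a translation is proper. -/
theorem isProperMap_of_norm_sub_add_le {V : Type*} [NormedAddCommGroup V] [ProperSpace V]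
    {x : V} {κ : ℝ} (hκ : κ < 1) {Φ : V → V} (hΦ : Continuous Φ)
    (hclose : ∀ v : V, ‖Φ v - (x + v)‖ ≤ κ * ‖v‖) : IsProperMap Φ := by
  refine isProperMap_iff_tendsto_cocompact.mpr ⟨hΦ, ?_⟩
  rw [← Metric.cobounded_eq_cocompact, ← tendsto_norm_atTop_iff_cobounded]
  have hlower : ∀ v, (1 - κ) * ‖v‖ - ‖x‖ ≤ ‖Φ v‖ := fun v ↦ by
    linarith [one_sub_mul_norm_le_norm_sub (hclose v), norm_sub_le (Φ v) x]
  refine Filter.tendsto_atTop_mono hlower (Filter.tendsto_atTop_add_const_right _ _ ?_)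
  exact tendsto_norm_cobounded_atTop.const_mul_atTop (sub_pos.mpr hκ)

theorem stmt_3 {V : Type*} [NormedAddCommGroup V] [NormedSpace ℝ V]
    [FiniteDimensional ℝ V] (x : V) (κ : ℝ)
    (hκ0 : 0 ≤ κ) (hκ : κ < 1) (Φ : V → V) (hΦ : Continuous Φ)
    (hbij : Function.Bijective Φ)
    (hclose : ∀ v : V, ‖Φ v - (x + v)‖ ≤ κ * ‖v‖) :
    IsHomeomorph Φ ∧
      ∀ w : V, ‖Function.invFun Φ w - (w - x)‖ ≤ κ / (1 - κ) * ‖w - x‖ := by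
  have : ProperSpace V := FiniteDimensional.proper ℝ V
  refine ⟨isHomeomorph_iff_continuous_isClosedMap_bijective.mpr
    ⟨hΦ, (isProperMap_of_norm_sub_add_le hκ hΦ hclose).isClosedMap, hbij⟩, fun w ↦ ?_⟩
  obtain ⟨v, rfl⟩ := hbij.surjective w
  rw [Function.leftInverse_invFun hbij.injective v]
  have hpos : 0 < 1 - κ := sub_pos.mpr hκ
  calc ‖v - (Φ v - x)‖ = ‖Φ v - (x + v)‖ := by
        rw [norm_sub_rev, sub_sub]
    _ ≤ κ * ‖v‖ := hclose v
    _ ≤ κ * (‖Φ v - x‖ / (1 - κ)) := by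
        gcongr
        rw [le_div_iff₀' hpos]
        exact one_sub_mul_norm_le_norm_sub (hclose v)
    _ = κ / (1 - κ) * ‖Φ v - x‖ := by ring
end

section
/- Let E ⊆ ℝ² be a nonempty open connected set such that every connected component of the complement ℝ² \ E is unbounded. Then E, endowed with the subspace topology, is simply connected. -/
namespace HexLattice

/-- Adjacency (including equality) in the triangular lattice on `ℤ × ℤ`. -/
def Adj (a b : ℤ × ℤ) : Prop :=
  |b.1 - a.1| ≤ 1 ∧ |b.2 - a.2| ≤ 1 ∧ |b.1 + b.2 - (a.1 + a.2)| ≤ 1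

/-- The open vertical half-line of lattice points strictly above `x`. -/
def Above (x u : ℤ × ℤ) : Prop := u.1 = x.1 ∧ x.2 < u.2

open Classical in
/-- The signed number of times that the step from `u` to `v` crosses the upward ray
at the right of the points above `x`. -/
noncomputable def crossing (x u v : ℤ × ℤ) : ℤ :=
  (if Above x u ∧ v.1 = u.1 + 1 then 1 else 0) - (if Above x v ∧ u.1 = v.1 + 1 then 1 else 0)

/-- The crossing cochain at `x` is a coboundary on `F`. -/
def CrossingTrivial (F : Finset (ℤ × ℤ)) (x : ℤ × ℤ) : Prop :=
  ∃ ψ : ℤ × ℤ → ℤ, ∀ u ∈ F, ∀ v ∈ F, Adj u v → ψ v - ψ u = crossing x u v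

/-- The points from which one can leave every box by a lattice path avoiding `T`. -/
inductive Escapes (T : Set (ℤ × ℤ)) (R : ℤ) : ℤ × ℤ → Prop
  | outside (x) (h : x.1 < -R ∨ R < x.1 ∨ R < x.2) : Escapes T R x
  | step (x y) (hx : x ∉ T) (hxy : Adj x y) (hy : Escapes T R y) : Escapes T R x

theorem Adj.refl (a : ℤ × ℤ) : Adj a a := by simp [Adj]

theorem Adj.symm {a b : ℤ × ℤ} (h : Adj a b) : Adj b a := by
  simp only [Adj, abs_le] at *; omega

theorem Escapes.of_forall_row {T : Set (ℤ × ℤ)} {R : ℤ} (j : ℤ) (h : ∀ i, (i, j) ∉ T) (i : ℤ) :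
    Escapes T R (i, j) := by
  by_cases hi : R < i
  · exact .outside _ (by simp [hi])
  · obtain ⟨n, hn⟩ : ∃ n : ℕ, i = R + 1 - n := ⟨(R + 1 - i).toNat, by omega⟩
    clear hi
    induction n generalizing i with
    | zero => exact .outside _ (by simp [hn])
    | succ n ih =>
      refine .step (i, j) (i + 1, j) (h i) (by simp [Adj]) (ih _ ?_)
      push_cast at hn
      omega

theorem crossingTrivial_of_adj {F : Finset (ℤ × ℤ)} {x y : ℤ × ℤ} (hx : x ∉ F) (hy : y ∉ F)
    (hxy : Adj x y) (h : CrossingTrivial F y) : CrossingTrivial F x := by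
  classical
  obtain ⟨ψ, hψ⟩ := h
  obtain ⟨i, j⟩ := x
  obtain ⟨k, l⟩ := y
  refine ⟨fun u => ψ u + (if k = i + 1 ∧ Above (k, l) u then 1 else 0)
    - (if i = k + 1 ∧ Above (i, j) u then 1 else 0), fun u hu v hv huv => ?_⟩
  have hψ' := hψ u hu v hv huv
  have h1 : u ≠ (i, j) := fun e => hx (e ▸ hu)
  have h2 : v ≠ (i, j) := fun e => hx (e ▸ hv)
  have h3 : u ≠ (k, l) := fun e => hy (e ▸ hu)
  have h4 : v ≠ (k, l) := fun e => hy (e ▸ hv)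
  obtain ⟨a, b⟩ := u
  obtain ⟨c, d⟩ := v
  beta_reduce
  generalize ψ (a, b) = p at *
  generalize ψ (c, d) = q at *
  clear hψ hx hy hu hv
  simp only [Adj, Above, crossing, abs_le, ne_eq, Prod.mk.injEq] at *
  obtain rfl | rfl | rfl : k = i - 1 ∨ k = i ∨ k = i + 1 := by omega
  all_goals
    obtain rfl | rfl | rfl : c = a - 1 ∨ c = a ∨ c = a + 1 := by omega
    all_goals grind (splits := 20)

theorem crossingTrivial_of_escapes {T : Set (ℤ × ℤ)} {R : ℤ} {F : Finset (ℤ × ℤ)}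
    (hF : ∀ x, x ∈ F ↔ ¬ Escapes T R x) {x : ℤ × ℤ} (hx : Escapes T R x) :
    CrossingTrivial F x := by
  induction hx with
  | outside x h =>
    have key : ∀ u ∈ F, ¬ Above x u := by
      intro u hu hxu
      refine (hF u).1 hu (.outside _ ?_)
      simp only [Above] at hxu
      omega
    exact ⟨0, fun u hu v hv _ => by simp [crossing, key u hu, key v hv]⟩
  | step x y hx hxy hy ih =>
    refine crossingTrivial_of_adj ?_ ?_ hxy ih
    · rw [hF, not_not]; exact .step _ _ hx hxy hy
    · rwa [hF, not_not]

/-- A cocycle on a finite set `F` of lattice points with values in a group, possibly noncommutative,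
is a coboundary as soon as no point outside `F` is enclosed by `F`. -/
theorem exists_potential {G : Type*} [Group G] (g : ℤ × ℤ → ℤ × ℤ → G) (F : Finset (ℤ × ℤ))
    (hg : ∀ a ∈ F, ∀ b ∈ F, ∀ c ∈ F, Adj a b → Adj b c → Adj a c → g b c * g a b = g a c)
    (hF : ∀ x ∉ F, CrossingTrivial F x) :
    ∃ h : ℤ × ℤ → G, ∀ a ∈ F, ∀ b ∈ F, Adj a b → g a b * h a = h b := by
  classical
  induction F using Finset.induction_on_max_value (fun x : ℤ × ℤ => toLex (x.2, x.1)) with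
  | empty => exact ⟨1, by simp⟩
  | insert v F hv hmax ih =>
    have hmax' : ∀ u ∈ F, u.2 < v.2 ∨ u.2 = v.2 ∧ u.1 < v.1 := by
      intro u hu
      have h1 := hmax u hu
      rw [Prod.Lex.toLex_le_toLex] at h1
      have h2 : u ≠ v := fun e => hv (e ▸ hu)
      rw [ne_eq, Prod.ext_iff] at h2
      simp only at h1
      omega
    obtain ⟨h, hh⟩ := ih
      (fun a ha b hb c hc => hg a (by simp [ha]) b (by simp [hb]) c (by simp [hc]))
      (fun x hx => by
        by_cases hxv : x = v
        · subst hxv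
          have key : ∀ u ∈ F, ¬ Above x u := by
            intro u hu hxu
            have := hmax' u hu
            simp only [Above] at hxu
            omega
          exact ⟨0, fun u hu w hw _ => by simp [crossing, key u hu, key w hw]⟩
        · obtain ⟨ψ, hψ⟩ := hF x (by simp [hx, hxv])
          exact ⟨ψ, fun u hu w hw => hψ u (by simp [hu]) w (by simp [hw])⟩)
    -- it suffices to satisfy the equations inside `F` and those from `F` to `v`
    suffices H : ∃ h : ℤ × ℤ → G, (∀ a ∈ F, ∀ b ∈ F, Adj a b → g a b * h a = h b) ∧
        ∀ a ∈ F, Adj a v → g a v * h a = h v by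
      obtain ⟨h, h1, h2⟩ := H
      have hvv : g v v = 1 := by
        have := hg v (by simp) v (by simp) v (by simp) (.refl _) (.refl _) (.refl _)
        simpa using this
      refine ⟨h, fun a ha b hb hab => ?_⟩
      rw [Finset.mem_insert] at ha hb
      rcases ha with rfl | ha <;> rcases hb with rfl | hb
      · simp [hvv]
      · have := hg a (by simp) b (by simp [hb]) a (by simp) hab hab.symm (.refl _)
        rw [hvv, mul_eq_one_iff_eq_inv'] at this
        rw [← h2 b hb hab.symm, this]
        simp
      · exact h2 a ha hab
      · exact h1 a ha b hb hab
    set L : ℤ × ℤ := (v.1 - 1, v.2) with hL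
    set P : ℤ × ℤ := (v.1, v.2 - 1) with hP
    set Q : ℤ × ℤ := (v.1 + 1, v.2 - 1) with hQ
    have hnbr : ∀ a ∈ F, Adj a v → a = L ∨ a = P ∨ a = Q := by
      intro a ha hav
      have := hmax' a ha
      simp only [Adj, abs_le] at hav
      simp only [hL, hP, hQ, Prod.ext_iff]
      omega
    have hLP : Adj L P := by simp [Adj, hL, hP, abs_le]; omega
    have hQP : Adj Q P := by simp [Adj, hQ, hP]
    have hLv : Adj L v := by simp [Adj, hL]
    have hPv : Adj P v := by simp [Adj, hP]
    have hQv : Adj Q v := by simp [Adj, hQ]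
    have hne : ∀ a ∈ F, a ≠ v := fun a ha e => hv (e ▸ ha)
    by_cases hPF : P ∈ F
    · refine ⟨Function.update h v (g P v * h P), fun a ha b hb hab => ?_, fun a ha hav => ?_⟩
      · rw [Function.update_of_ne (hne a ha), Function.update_of_ne (hne b hb)]
        exact hh a ha b hb hab
      · rw [Function.update_of_ne (hne a ha), Function.update_self]
        have haP : Adj a P := by
          rcases hnbr a ha hav with rfl | rfl | rfl
          exacts [hLP, .refl _, hQP]
        rw [← hh a ha P hPF haP, ← mul_assoc,
          hg a (by simp [ha]) P (by simp [hPF]) v (by simp) haP hPv hav]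
    · have hPv' : P ≠ v := by simp [hP, Prod.ext_iff]
      obtain ⟨ψ, hψ⟩ := hF P (by simp [hPF, hPv'])
      have hψF : ∀ a ∈ F, ∀ b ∈ F, Adj a b → ψ a = ψ b := by
        intro a ha b hb hab
        have h1 := hψ a (by simp [ha]) b (by simp [hb]) hab
        have key : ∀ u ∈ F, ¬ Above P u := by
          intro u hu hxu
          have := hmax' u hu
          simp only [Above, hP] at hxu
          omega
        simp only [crossing, key a ha, key b hb, false_and, if_false, sub_zero] at h1
        omega
      have hψL : L ∈ F → ψ L = ψ v := by
        intro hLF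
        have h1 := hψ L (by simp [hLF]) v (by simp) hLv
        simp [crossing, Above, hL, hP] at h1
        grind
      have hψQ : Q ∈ F → ψ Q = ψ v + 1 := by
        intro hQF
        have h1 := hψ Q (by simp [hQF]) v (by simp) hQv
        simp [crossing, Above, hQ, hP] at h1
        grind
      set κ : G := (g Q v * h Q)⁻¹ * (g L v * h L) with hκ
      refine ⟨fun u => if u = v then g L v * h L else if ψ u = ψ v + 1 then h u * κ else h u,
        fun a ha b hb hab => ?_, fun a ha hav => ?_⟩
      · simp only [hne a ha, hne b hb, if_false, hψF a ha b hb hab]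
        split_ifs
        · rw [← mul_assoc, hh a ha b hb hab]
        · exact hh a ha b hb hab
      · simp only [hne a ha, if_false, if_true]
        rcases hnbr a ha hav with rfl | rfl | rfl
        · simp [hψL ha]
        · exact absurd ha hPF
        · simp [hψQ ha, hκ]
          group

end HexLattice

section Convex

open CategoryTheory Set unitInterval

variable {V : Type*} [AddCommGroup V] [Module ℝ V] [TopologicalSpace V]

/-- Two paths with the same endpoints in a convex subset of `E` are homotopic in `E`. -/
theorem Path.homotopic_of_mem_convex [IsTopologicalAddGroup V] [ContinuousSMul ℝ V]
    {E S : Set V} (hS : Convex ℝ S) (hSE : S ⊆ E) {x y : E}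
    {γ γ' : Path x y} (h : ∀ t, (γ t : V) ∈ S) (h' : ∀ t, (γ' t : V) ∈ S) : γ.Homotopic γ' := by
  have hmem : ∀ p : I × I,
      (1 - (p.1 : ℝ)) • (γ p.2 : V) + (p.1 : ℝ) • (γ' p.2 : V) ∈ E := fun p =>
    hSE (hS (h _) (h' _) (sub_nonneg.2 p.1.2.2) p.1.2.1 (sub_add_cancel _ _))
  have hcont : Continuous fun p : I × I =>
      (⟨(1 - (p.1 : ℝ)) • (γ p.2 : V) + (p.1 : ℝ) • (γ' p.2 : V), hmem p⟩ : E) :=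
    Continuous.subtype_mk (by fun_prop) _
  exact ⟨{
    toContinuousMap := ⟨_, hcont⟩
    map_zero_left := fun t => Subtype.ext (by simp)
    map_one_left := fun t => Subtype.ext (by simp)
    prop' := by
      intro t s hs
      refine Subtype.ext ?_
      have hss : γ s = γ' s := by
        rcases hs with rfl | rfl
        · rw [γ.source, γ'.source]
        · rw [γ.target, γ'.target]
      change (1 - (t : ℝ)) • (γ s : V) + (t : ℝ) • (γ' s : V) = (γ s : V)
      rw [← hss, ← add_smul, sub_add_cancel, one_smul] }⟩

/-- In a path connected set `E` there is a choice of homotopy classes of paths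
which is represented by every path contained in some convex subset of `E`. -/
theorem exists_straight_hom [IsTopologicalAddGroup V] [ContinuousSMul ℝ V]
    (E : Set V) [PathConnectedSpace E] :
    ∃ l : ∀ x y : E, FundamentalGroupoid.mk x ⟶ FundamentalGroupoid.mk y,
      (∀ S ⊆ E, Convex ℝ S → ∀ (x y : E) (γ : Path x y), (∀ t, (γ t : V) ∈ S) →
        FundamentalGroupoid.fromPath (Path.Homotopic.Quotient.mk γ) = l x y) ∧
      ∀ S ⊆ E, Convex ℝ S → ∀ x y z : E, (x : V) ∈ S → (y : V) ∈ S → (z : V) ∈ S →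
        l x y ≫ l y z = l x z := by
  classical
  have hline : ∀ x y : E, segment ℝ (x : V) y ⊆ E →
      ∃ γ : Path x y, ∀ t, (γ t : V) ∈ segment ℝ (x : V) y := by
    intro x y hxy
    have hmem : ∀ t : I, (1 - (t : ℝ)) • (x : V) + (t : ℝ) • (y : V) ∈ segment ℝ (x : V) y :=
      fun t => ⟨_, _, sub_nonneg.2 t.2.2, t.2.1, sub_add_cancel _ _, rfl⟩
    have hcont : Continuous fun t : I =>
        (⟨(1 - (t : ℝ)) • (x : V) + (t : ℝ) • (y : V), hxy (hmem t)⟩ : E) :=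
      Continuous.subtype_mk (by fun_prop) _
    exact ⟨{
      toContinuousMap := ⟨_, hcont⟩
      source' := Subtype.ext (by simp)
      target' := Subtype.ext (by simp) }, hmem⟩
  have hex : ∀ x y : E, ∃ γ : Path x y, segment ℝ (x : V) y ⊆ E →
      ∀ t, (γ t : V) ∈ segment ℝ (x : V) y := by
    intro x y
    by_cases h : segment ℝ (x : V) y ⊆ E
    · obtain ⟨γ, hγ⟩ := hline x y h
      exact ⟨γ, fun _ => hγ⟩
    · exact ⟨PathConnectedSpace.somePath x y, fun h' => absurd h' h⟩
  choose δ hδ using hex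
  have hδS : ∀ S ⊆ E, Convex ℝ S → ∀ x y : E, (x : V) ∈ S → (y : V) ∈ S →
      ∀ t, (δ x y t : V) ∈ S := fun S hSE hS x y hx hy t =>
    hS.segment_subset hx hy (hδ x y ((hS.segment_subset hx hy).trans hSE) t)
  have key : ∀ S ⊆ E, Convex ℝ S → ∀ (x y : E) (γ : Path x y), (∀ t, (γ t : V) ∈ S) →
      γ.Homotopic (δ x y) := by
    intro S hSE hS x y γ hγ
    have hx : (x : V) ∈ S := by simpa using hγ 0
    have hy : (y : V) ∈ S := by simpa using hγ 1
    exact Path.homotopic_of_mem_convex hS hSE hγ (hδS S hSE hS x y hx hy)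
  refine ⟨fun x y => FundamentalGroupoid.fromPath (Path.Homotopic.Quotient.mk (δ x y)), ?_, ?_⟩
  · intro S hSE hS x y γ hγ
    exact (FundamentalGroupoid.fromPath_eq_iff_homotopic _ _).2 (key S hSE hS x y γ hγ)
  · intro S hSE hS x y z hx hy hz
    refine (FundamentalGroupoid.fromPath_eq_iff_homotopic ((δ x y).trans (δ y z)) _).2
      (key S hSE hS x z _ fun t => ?_)
    rw [Path.trans_apply]
    split_ifs
    · exact hδS S hSE hS x y hx hy _
    · exact hδS S hSE hS y z hy hz _

open HexLattice in
/-- A finite family of convex subsets of `E` indexed by lattice points, with nerve the triangular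
lattice and enclosing no lattice point, admits a choice of homotopy classes of paths from a base
point which is compatible with straight paths inside each member of the family. -/
theorem exists_compatible_hom {E : Set V} {U : ℤ × ℤ → Set V} {F : Finset (ℤ × ℤ)}
    (hne : ∀ a, (U a).Nonempty)
    (hUE : ∀ a ∈ F, U a ⊆ E) (hU : ∀ a, Convex ℝ (U a))
    (hadj : ∀ a b, (U a ∩ U b).Nonempty → Adj a b)
    (htriple : ∀ a b c, Adj a b → Adj b c → Adj a c → (U a ∩ U b ∩ U c).Nonempty)
    (hF : ∀ x ∉ F, CrossingTrivial F x)
    {l : ∀ x y : E, FundamentalGroupoid.mk x ⟶ FundamentalGroupoid.mk y}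
    (hl : ∀ S ⊆ E, Convex ℝ S → ∀ x y z : E, (x : V) ∈ S → (y : V) ∈ S → (z : V) ∈ S →
        l x y ≫ l y z = l x z) (x₀ : E) :
    ∃ H : ∀ p : E, FundamentalGroupoid.mk x₀ ⟶ FundamentalGroupoid.mk p,
      ∀ a ∈ F, ∀ p q : E, (p : V) ∈ U a → (q : V) ∈ U a → H p ≫ l p q = H q := by
  classical
  have hz : ∀ a, ∃ z : E, a ∈ F → (z : V) ∈ U a := by
    intro a
    by_cases ha : a ∈ F
    · obtain ⟨p, hp⟩ := hne a
      exact ⟨⟨p, hUE a ha hp⟩, fun _ => hp⟩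
    · exact ⟨x₀, fun h => absurd h ha⟩
  choose z hz using hz
  obtain ⟨s, hs⟩ : ∃ s : ∀ (_ : ℤ × ℤ) (p : E),
      FundamentalGroupoid.mk x₀ ⟶ FundamentalGroupoid.mk p, ∀ a ∈ F, ∀ p q : E,
        (p : V) ∈ U a → (q : V) ∈ U a → s a p ≫ l p q = s a q := by
    refine ⟨fun a p => l x₀ (z a) ≫ l (z a) p, fun a ha p q hp hq => ?_⟩
    rw [Category.assoc, hl (U a) (hUE a ha) (hU a) (z a) p q (hz a ha) hp hq]
  have hg : ∀ a b, ∃ g : End (FundamentalGroupoid.mk x₀), a ∈ F → b ∈ F →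
      ∀ p : E, (p : V) ∈ U a → (p : V) ∈ U b → s a p = g ≫ s b p := by
    intro a b
    by_cases h : ∃ m : E, (m : V) ∈ U a ∧ (m : V) ∈ U b
    · obtain ⟨m, hma, hmb⟩ := h
      refine ⟨s a m ≫ Groupoid.inv (s b m), fun ha hb p hpa hpb => ?_⟩
      rw [← hs a ha m p hma hpa, ← hs b hb m p hmb hpb]
      simp
    · exact ⟨𝟙 _, fun _ _ p hpa hpb => absurd ⟨p, hpa, hpb⟩ h⟩
  choose g hg using hg
  obtain ⟨h, hh⟩ := exists_potential g F (by
    intro a ha b hb c hc hab hbc hac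
    obtain ⟨p, ⟨hpa, hpb⟩, hpc⟩ := htriple a b c hab hbc hac
    lift p to E using hUE a ha hpa
    have h1 := hg a b ha hb p hpa hpb
    have h2 := hg b c hb hc p hpb hpc
    have h3 := hg a c ha hc p hpa hpc
    rw [h2, h3, ← Category.assoc, cancel_mono] at h1
    rw [End.mul_def]
    exact h1.symm) hF
  let i : E → ℤ × ℤ := fun p => if hp : ∃ a ∈ F, (p : V) ∈ U a then hp.choose else 0
  have hi : ∀ a ∈ F, ∀ p : E, (p : V) ∈ U a → i p ∈ F ∧ (p : V) ∈ U (i p) := by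
    intro a ha p hp
    have hex : ∃ a ∈ F, (p : V) ∈ U a := ⟨a, ha, hp⟩
    simp only [i, dif_pos hex]
    exact hex.choose_spec
  have key : ∀ a ∈ F, ∀ p : E, (p : V) ∈ U a →
      (h (i p) : FundamentalGroupoid.mk x₀ ⟶ _) ≫ s (i p) p = h a ≫ s a p := by
    intro a ha p hp
    obtain ⟨h1, h2⟩ := hi a ha p hp
    rw [← hh a ha (i p) h1 (hadj _ _ ⟨p, hp, h2⟩), End.mul_def, Category.assoc,
      ← hg a (i p) ha h1 p hp h2]
  refine ⟨fun p => (h (i p) : FundamentalGroupoid.mk x₀ ⟶ _) ≫ s (i p) p, ?_⟩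
  intro a ha p q hp hq
  simp only [key a ha p hp, key a ha q hq, Category.assoc, hs a ha p q hp hq]

/-- A loop covered by convex open sets along which homotopy classes of paths from a base point
are chosen compatibly is nullhomotopic. -/
theorem Path.homotopic_refl_of_compatible {E : Set V} {ι : Type*} {U : ι → Set V} {F : Set ι}
    (hUE : ∀ a ∈ F, U a ⊆ E) (hU : ∀ a, Convex ℝ (U a)) (hUo : ∀ a, IsOpen (U a))
    {l : ∀ x y : E, FundamentalGroupoid.mk x ⟶ FundamentalGroupoid.mk y}
    (hl : ∀ S ⊆ E, Convex ℝ S → ∀ (x y : E) (γ : Path x y), (∀ t, (γ t : V) ∈ S) →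
        FundamentalGroupoid.fromPath (Path.Homotopic.Quotient.mk γ) = l x y) {x₀ : E}
    {H : ∀ p : E, FundamentalGroupoid.mk x₀ ⟶ FundamentalGroupoid.mk p}
    (hH : ∀ a ∈ F, ∀ p q : E, (p : V) ∈ U a → (q : V) ∈ U a → H p ≫ l p q = H q)
    {x : E} (γ : Path x x) (hγ : ∀ t, ∃ a ∈ F, (γ t : V) ∈ U a) : γ.Homotopic (Path.refl x) := by
  obtain ⟨t, ht0, htm, ⟨n, hn⟩, ht⟩ := exists_monotone_Icc_subset_open_cover_unitInterval
    (c := fun a : F => {t : I | (γ t : V) ∈ U a})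
    (fun a => (hUo a).preimage (by fun_prop)) (by
      intro t _
      obtain ⟨a, ha, hta⟩ := hγ t
      exact mem_iUnion.2 ⟨⟨a, ha⟩, hta⟩)
  have key : ∀ n, H (γ 0) ≫ FundamentalGroupoid.fromPath
      (Path.Homotopic.Quotient.mk (γ.subpath 0 (t n))) = H (γ (t n)) := by
    intro n
    induction n with
    | zero =>
      rw [ht0, Path.subpath_self]
      exact Category.comp_id _
    | succ n ih =>
      obtain ⟨⟨a, ha⟩, hta⟩ := ht n
      have hle := htm n.le_succ
      have h1 : FundamentalGroupoid.fromPath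
          (Path.Homotopic.Quotient.mk (γ.subpath (t n) (t (n + 1)))) = l _ _ := by
        refine hl (U a) (hUE a ha) (hU a) _ _ _ fun s => ?_
        have : γ.subpath (t n) (t (n + 1)) s ∈ γ '' Icc (t n) (t (n + 1)) := by
          rw [← Path.range_subpath_of_le _ _ _ hle]; exact mem_range_self s
        obtain ⟨r, hr, hrs⟩ := this
        rw [← hrs]
        exact hta hr
      have h2 : FundamentalGroupoid.fromPath
          (Path.Homotopic.Quotient.mk (γ.subpath 0 (t (n + 1)))) = FundamentalGroupoid.fromPath
          (Path.Homotopic.Quotient.mk (γ.subpath 0 (t n))) ≫ FundamentalGroupoid.fromPath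
          (Path.Homotopic.Quotient.mk (γ.subpath (t n) (t (n + 1)))) :=
        ((FundamentalGroupoid.fromPath_eq_iff_homotopic
          ((γ.subpath 0 (t n)).trans (γ.subpath (t n) (t (n + 1)))) _).2
          ⟨Path.Homotopy.subpathTransSubpath γ 0 (t n) (t (n + 1))⟩).symm
      rw [h2, ← Category.assoc, ih, h1]
      exact hH a ha _ _ (hta ⟨le_rfl, hle⟩) (hta ⟨hle, le_rfl⟩)
  have h1 := key n
  rw [hn n le_rfl] at h1
  have h2 : H x ≫ FundamentalGroupoid.fromPath (Path.Homotopic.Quotient.mk γ) = H x := by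
    rw [Path.subpath_zero_one] at h1
    have aux : ∀ (p q : E) (hp : p = x) (hq : q = x),
        H p ≫ FundamentalGroupoid.fromPath (Path.Homotopic.Quotient.mk (γ.cast hp hq)) = H q →
        H x ≫ FundamentalGroupoid.fromPath (Path.Homotopic.Quotient.mk γ) = H x := by
      rintro _ _ rfl rfl h
      exact h
    exact aux _ _ _ _ h1
  rw [← FundamentalGroupoid.fromPath_eq_iff_homotopic, ← cancel_epi (H x), h2]
  exact (Category.comp_id _).symm

end Convex

namespace HexLattice

/-- The open hexagon of size `ε` around the point `ε • a` of the scaled lattice. -/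
def hexagon (ε : ℝ) (a : ℤ × ℤ) : Set (EuclideanSpace ℝ (Fin 2)) :=
  {p | |p 0 - ε * a.1| < ε ∧ |p 1 - ε * a.2| < ε ∧ |p 0 + p 1 - ε * (a.1 + a.2)| < ε}

theorem isOpen_hexagon (ε : ℝ) (a : ℤ × ℤ) : IsOpen (hexagon ε a) := by
  have key : ∀ (f : EuclideanSpace ℝ (Fin 2) → ℝ) (_ : Continuous f) (c : ℝ),
      IsOpen {p | |f p - c| < ε} := fun f hf c => isOpen_lt (by fun_prop) continuous_const
  exact (key (fun p => p 0) (by fun_prop) _).inter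
    ((key (fun p => p 1) (by fun_prop) _).inter (key (fun p => p 0 + p 1) (by fun_prop) _))

theorem convex_hexagon (ε : ℝ) (a : ℤ × ℤ) : Convex ℝ (hexagon ε a) := by
  have key : ∀ (f : EuclideanSpace ℝ (Fin 2) → ℝ) (_ : IsLinearMap ℝ f) (c : ℝ),
      Convex ℝ {p | |f p - c| < ε} := by
    intro f hf c
    exact (convex_ball c ε).is_linear_preimage hf
  refine (key (fun p => p 0) ⟨by simp, by simp⟩ _).inter
    ((key (fun p => p 1) ⟨by simp, by simp⟩ _).inter
      (key (fun p => p 0 + p 1) ⟨fun x y => ?_, fun c x => ?_⟩ _))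
  · simp only [PiLp.add_apply]; ring
  · simp only [PiLp.smul_apply, smul_eq_mul]; ring

theorem exists_mem_hexagon {ε : ℝ} (hε : 0 < ε) (p : EuclideanSpace ℝ (Fin 2)) :
    ∃ a, p ∈ hexagon ε a := by
  obtain ⟨x, hx⟩ : ∃ x, p 0 = ε * x := ⟨p 0 / ε, by field_simp⟩
  obtain ⟨y, hy⟩ : ∃ y, p 1 = ε * y := ⟨p 1 / ε, by field_simp⟩
  have key : ∀ i j : ℤ, |x - i| < 1 → |y - j| < 1 → |x + y - (i + j)| < 1 →
      p ∈ hexagon ε (i, j) := by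
    intro i j h1 h2 h3
    simp only [hexagon, Set.mem_ofPred_eq, hx, hy, ← mul_sub, ← mul_add, abs_mul, abs_of_pos hε]
    exact ⟨mul_lt_of_lt_one_right hε h1, mul_lt_of_lt_one_right hε h2,
      mul_lt_of_lt_one_right hε h3⟩
  have h1 := Int.floor_le x
  have h2 := Int.lt_floor_add_one x
  have h3 := Int.floor_le y
  have h4 := Int.lt_floor_add_one y
  by_cases h : x + y - (⌊x⌋ + ⌊y⌋) < 1
  · refine ⟨_, key ⌊x⌋ ⌊y⌋ ?_ ?_ ?_⟩ <;> rw [abs_lt] <;> constructor <;> linarith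
  · refine ⟨_, key (⌊x⌋ + 1) ⌊y⌋ ?_ ?_ ?_⟩ <;> push_cast <;> rw [abs_lt] <;> constructor <;> linarith

theorem abs_le_one_of_abs_lt {ε x : ℝ} {m n : ℤ} (hε : 0 < ε) (hm : |x - ε * m| < ε)
    (hn : |x - ε * n| < ε) : |n - m| ≤ 1 := by
  rw [abs_lt] at hm hn
  have h1 : ((n - m : ℤ) : ℝ) < 2 := by
    push_cast
    refine lt_of_mul_lt_mul_left (a := ε) ?_ hε.le
    linarith
  have h2 : ((m - n : ℤ) : ℝ) < 2 := by
    push_cast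
    refine lt_of_mul_lt_mul_left (a := ε) ?_ hε.le
    linarith
  have h1' : n - m < 2 := by exact_mod_cast h1
  have h2' : m - n < 2 := by exact_mod_cast h2
  rw [abs_le]
  omega

theorem adj_of_mem_hexagon {ε : ℝ} (hε : 0 < ε) {a b : ℤ × ℤ} {p : EuclideanSpace ℝ (Fin 2)}
    (ha : p ∈ hexagon ε a) (hb : p ∈ hexagon ε b) : Adj a b := by
  obtain ⟨h1, h2, h3⟩ := ha
  obtain ⟨h4, h5, h6⟩ := hb
  exact ⟨abs_le_one_of_abs_lt hε h1 h4, abs_le_one_of_abs_lt hε h2 h5,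
    abs_le_one_of_abs_lt (x := p 0 + p 1) hε (by push_cast; exact h3)
      (by push_cast; exact h6)⟩

/-- The hexagons around three pairwise adjacent lattice points meet at their centroid. -/
theorem nonempty_inter_hexagon {ε : ℝ} (hε : 0 < ε) {a b c : ℤ × ℤ} (hab : Adj a b)
    (hbc : Adj b c) (hac : Adj a c) :
    (hexagon ε a ∩ hexagon ε b ∩ hexagon ε c).Nonempty := by
  have key : ∀ a b c : ℤ × ℤ, Adj a b → Adj a c →
      !₂[ε * ((a.1 + b.1 + c.1) / 3), ε * ((a.2 + b.2 + c.2) / 3)] ∈ hexagon ε a := by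
    intro a b c hab hac
    have e : ∀ k m n : ℤ, |m - k| ≤ 1 → |n - k| ≤ 1 →
        |((k : ℝ) + m + n) / 3 - k| < 1 := by
      intro k m n h1 h2
      have h1' : |(m : ℝ) - k| ≤ 1 := by exact_mod_cast h1
      have h2' : |(n : ℝ) - k| ≤ 1 := by exact_mod_cast h2
      rw [abs_le] at h1' h2'
      rw [abs_lt]
      constructor <;> linarith
    have h3 := e _ _ _ hab.2.2 hac.2.2
    push_cast at h3
    simp only [hexagon, Set.mem_ofPred_eq, Matrix.cons_val_zero,
      Matrix.cons_val_one, ← mul_sub, ← mul_add, abs_mul, abs_of_pos hε]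
    refine ⟨mul_lt_of_lt_one_right hε (e _ _ _ hab.1 hac.1),
      mul_lt_of_lt_one_right hε (e _ _ _ hab.2.1 hac.2.1), mul_lt_of_lt_one_right hε ?_⟩
    rwa [show ((a.1 : ℝ) + b.1 + c.1) / 3 + (a.2 + b.2 + c.2) / 3 - (a.1 + a.2) =
      (a.1 + a.2 + (b.1 + b.2) + (c.1 + c.2)) / 3 - (a.1 + a.2) by ring]
  refine ⟨_, ⟨key a b c hab hac, ?_⟩, ?_⟩
  · have h := key b a c hab.symm hbc
    rwa [add_comm (b.1 : ℝ), add_comm (b.2 : ℝ)] at h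
  · have h := key c a b hac.symm hbc.symm
    rwa [add_assoc (c.1 : ℝ), add_assoc (c.2 : ℝ), add_comm (c.1 : ℝ), add_comm (c.2 : ℝ)] at h

theorem dist_lt_of_mem_hexagon {ε : ℝ} {a : ℤ × ℤ} {p q : EuclideanSpace ℝ (Fin 2)}
    (hp : p ∈ hexagon ε a) (hq : q ∈ hexagon ε a) : dist p q < 4 * ε := by
  obtain ⟨h1, h2, -⟩ := hp
  obtain ⟨h3, h4, -⟩ := hq
  rw [abs_lt] at h1 h2 h3 h4
  have h5 : |p 0 - q 0| < 2 * ε := by rw [abs_lt]; constructor <;> linarith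
  have h6 : |p 1 - q 1| < 2 * ε := by rw [abs_lt]; constructor <;> linarith
  have h7 := abs_nonneg (p 0 - q 0)
  have h8 := abs_nonneg (p 1 - q 1)
  rw [EuclideanSpace.dist_eq, Fin.sum_univ_two, Real.dist_eq, Real.dist_eq,
    Real.sqrt_lt' (by linarith)]
  nlinarith

theorem exists_bound_of_isBounded {ε : ℝ} (hε : 0 < ε) {K : Set (EuclideanSpace ℝ (Fin 2))}
    (hK : Bornology.IsBounded K) :
    ∃ R : ℤ, ∀ a, (hexagon ε a ∩ K).Nonempty → |a.1| ≤ R ∧ |a.2| ≤ R := by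
  obtain ⟨B, hB⟩ := hK.exists_norm_le
  refine ⟨⌈B / ε + 1⌉, ?_⟩
  rintro a ⟨p, ⟨h1, h2, -⟩, hp⟩
  have hcoord : ∀ i, |p i| ≤ B := fun i => (PiLp.norm_apply_le p i).trans (hB p hp)
  have key : ∀ (x : ℝ) (k : ℤ), |x| ≤ B → |x - ε * k| < ε → |k| ≤ ⌈B / ε + 1⌉ := by
    intro x k hx hk
    have : |(k : ℝ)| ≤ B / ε + 1 := by
      have h3 : ε * |(k : ℝ)| ≤ B + ε := by
        rw [← abs_of_pos hε, ← abs_mul, abs_of_pos hε]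
        have := abs_sub_abs_le_abs_sub (ε * (k : ℝ)) x
        rw [abs_sub_comm] at this
        linarith
      rw [div_add_one hε.ne', le_div_iff₀ hε]
      linarith
    have := this.trans (Int.le_ceil _)
    exact_mod_cast this
  exact ⟨key _ _ (hcoord 0) h1, key _ _ (hcoord 1) h2⟩

/-- If the components of `Eᶜ` are unbounded, a hexagon that meets `Eᶜ` is centred at an escaping
point. -/
theorem hexagon_subset_of_not_escapes {E : Set (EuclideanSpace ℝ (Fin 2))} {ε : ℝ} (hε : 0 < ε)
    (hE : ∀ x ∈ Eᶜ, ¬Bornology.IsBounded (connectedComponentIn Eᶜ x)) {T : Set (ℤ × ℤ)}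
    (hT : ∀ a ∈ T, hexagon ε a ⊆ E) {R : ℤ} (hfin : {a | ¬ Escapes T R a}.Finite)
    {a : ℤ × ℤ} (ha : ¬ Escapes T R a) : hexagon ε a ⊆ E := by
  intro z hz
  by_contra hzE
  set Z := connectedComponentIn Eᶜ z
  have hZE : Z ⊆ Eᶜ := connectedComponentIn_subset _ _
  have hzZ : z ∈ Z := mem_connectedComponentIn hzE
  set A : Set (EuclideanSpace ℝ (Fin 2)) := ⋃ b ∈ {b | ¬ Escapes T R b}, hexagon ε b with hA
  set B : Set (EuclideanSpace ℝ (Fin 2)) := ⋃ b ∈ {b | Escapes T R b}, hexagon ε b with hB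
  have hAb : Bornology.IsBounded A := by
    refine (Bornology.isBounded_biUnion hfin).2 fun b _ => ?_
    exact Metric.isBounded_iff.2 ⟨4 * ε, fun p hp q hq => (dist_lt_of_mem_hexagon hp hq).le⟩
  have hcover : ∀ p, p ∈ A ∪ B := by
    intro p
    obtain ⟨b, hb⟩ := exists_mem_hexagon hε p
    by_cases h : Escapes T R b
    · exact .inr (Set.mem_biUnion (show b ∈ {b | Escapes T R b} from h) hb)
    · exact .inl (Set.mem_biUnion (show b ∈ {b | ¬ Escapes T R b} from h) hb)
  have hZB : (Z ∩ B).Nonempty := by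
    by_contra h
    refine hE z hzE (hAb.subset fun p hp => ?_)
    exact (hcover p).resolve_right fun hpB => h ⟨p, hp, hpB⟩
  obtain ⟨p, hpZ, hpA, hpB⟩ := isPreconnected_connectedComponentIn A B
    (isOpen_biUnion fun b _ => isOpen_hexagon ε b) (isOpen_biUnion fun b _ => isOpen_hexagon ε b)
    (fun p _ => hcover p) ⟨z, hzZ, Set.mem_biUnion (show a ∈ {b | ¬ Escapes T R b} from ha) hz⟩ hZB
  simp only [hA, hB, Set.mem_iUnion, Set.mem_ofPred_eq, exists_prop] at hpA hpB
  obtain ⟨b, hb, hpb⟩ := hpA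
  obtain ⟨c, hc, hpc⟩ := hpB
  exact hb (.step b c (fun hbT => hZE hpZ (hT b hbT hpb)) (adj_of_mem_hexagon hε hpb hpc) hc)

end HexLattice

open HexLattice in
theorem stmt_12 (E : Set (EuclideanSpace ℝ (Fin 2))) (hne : E.Nonempty)
    (hopen : IsOpen E) (hconn : IsConnected E)
    (hcomp : ∀ x ∈ Eᶜ, ¬Bornology.IsBounded (connectedComponentIn Eᶜ x)) :
    SimplyConnectedSpace E := by
  have hpc : PathConnectedSpace E :=
    isPathConnected_iff_pathConnectedSpace.1 (hopen.isConnected_iff_isPathConnected.1 hconn)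
  refine simply_connected_iff_loops_nullhomotopic.2 ⟨hpc, fun x γ => ?_⟩
  set K : Set (EuclideanSpace ℝ (Fin 2)) := Set.range fun t => (γ t : EuclideanSpace ℝ (Fin 2))
  have hK : IsCompact K := isCompact_range (by fun_prop)
  have hKE : K ⊆ E := by
    rintro _ ⟨t, rfl⟩
    exact (γ t).2
  obtain ⟨δ, hδ, hδE⟩ := hK.exists_thickening_subset_open hopen hKE
  obtain ⟨ε, hε, hεδ⟩ : ∃ ε : ℝ, 0 < ε ∧ 4 * ε ≤ δ := ⟨δ / 4, by positivity, by linarith⟩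
  set T : Set (ℤ × ℤ) := {a | (hexagon ε a ∩ K).Nonempty}
  have hTE : ∀ a ∈ T, hexagon ε a ⊆ E := by
    rintro a ⟨p, hpa, hpK⟩ q hq
    exact hδE (Metric.mem_thickening_iff.2
      ⟨p, hpK, (dist_lt_of_mem_hexagon hq hpa).trans_le hεδ⟩)
  obtain ⟨R, hR⟩ := exists_bound_of_isBounded hε hK.isBounded
  have hbox : ∀ a, ¬ Escapes T R a → a ∈ Set.Icc (-R) R ×ˢ Set.Icc (-R) R := by
    rintro ⟨i, j⟩ ha
    by_contra h
    rw [Set.mem_prod, Set.mem_Icc, Set.mem_Icc] at h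
    by_cases h' : i < -R ∨ R < i ∨ R < j
    · exact ha (.outside _ h')
    · refine ha (.of_forall_row j (fun k hk => ?_) i)
      have := (hR _ hk).2
      rw [abs_le] at this
      simp only at h this
      omega
  have hfin : {a | ¬ Escapes T R a}.Finite :=
    ((Set.finite_Icc _ _).prod (Set.finite_Icc _ _)).subset hbox
  have hF : ∀ x, x ∈ hfin.toFinset ↔ ¬ Escapes T R x := by simp
  have hFE : ∀ a ∈ hfin.toFinset, hexagon ε a ⊆ E := fun a ha =>
    hexagon_subset_of_not_escapes hε hcomp hTE hfin ((hF a).1 ha)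
  obtain ⟨l, hl₁, hl₂⟩ := exists_straight_hom E
  obtain ⟨H, hH⟩ := exists_compatible_hom (U := hexagon ε)
    (fun a => (nonempty_inter_hexagon hε (.refl a) (.refl a) (.refl a)).mono fun _ h => h.2)
    hFE (convex_hexagon ε) (fun a b ⟨_, ha, hb⟩ => adj_of_mem_hexagon hε ha hb)
    (fun a b c => nonempty_inter_hexagon hε)
    (fun y hy => crossingTrivial_of_escapes hF (by rwa [hF, not_not] at hy)) hl₂ x
  refine Path.homotopic_refl_of_compatible (F := {a | a ∈ hfin.toFinset}) hFE (convex_hexagon ε)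
    (isOpen_hexagon ε) hl₁ hH γ fun t => ?_
  obtain ⟨a, ha⟩ := exists_mem_hexagon hε (γ t)
  have haT : a ∈ T := ⟨_, ha, t, rfl⟩
  refine ⟨a, (hF a).2 fun hesc => ?_, ha⟩
  cases hesc with
  | outside _ h =>
    have := hR a haT
    rw [abs_le, abs_le] at this
    omega
  | step _ y h _ _ => exact h haT
end
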